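/- Let k⃗ = (kₙ)_{n∈ℕ} be an increasing sequence of positive integers, r, s ∈ ℕ and w⃗ ∈ L^∞(Σ,k⃗;υ). If L^{<∞}(Σ,k⃗;υ) = A₁ ∪ … ∪ A_r and L^{<∞}(Σ,k⃗) = C₁ ∪ … ∪ C_s, then there exist an extraction u⃗ ≺ w⃗ and indices 1 ≤ i₀ ≤ r, 1 ≤ j₀ ≤ s such that {(z₁,…,zₙ) : n ∈ ℕ, min dom(z₁) = n, z₁ < … < zₙ, each zᵢ ∈ EV(u⃗)} ⊆ A_{i₀} and {(z₁,…,zₙ) : n ∈ ℕ, min dom(z₁) = n, z₁ < … < zₙ, each zᵢ ∈ E(u⃗)} ⊆ C_{j₀}. -/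

import Mathlib

namespace Farmaki

/-- A located word over the alphabet `Σ ∪ {υ}`: positions are natural numbers,
`none` means the position is not in the domain, `some 0` is the variable `υ`,
and `some a` for `a ≥ 1` is the letter `αₐ`. -/
abbrev LWord := ℕ → Option ℕ

/-- The domain of a located word. -/
def dom (w : LWord) : Set ℕ := {n | w n ≠ none}

/-- `min dom(w)`. -/
noncomputable def minDom (w : LWord) : ℕ := sInf (dom w)

/-- A variable ω-located word over `Σ` dominated by `k`. -/
def IsVarWord (k : ℕ → ℕ) (w : LWord) : Prop :=
  (dom w).Finite ∧ (dom w).Nonempty ∧ (∀ n a, w n = some a → a ≤ k n) ∧ ∃ n, w n = some 0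

/-- A (constant) ω-located word over `Σ` dominated by `k`. -/
def IsConstWord (k : ℕ → ℕ) (w : LWord) : Prop :=
  (dom w).Finite ∧ (dom w).Nonempty ∧ ∀ n a, w n = some a → 1 ≤ a ∧ a ≤ k n

/-- `w < u` iff `max dom(w) < min dom(u)`. -/
def wlt (w u : LWord) : Prop := ∀ m n, w m ≠ none → u n ≠ none → m < n

/-- Concatenation `w ⋆ u` of located words (union of graphs, `w` taking precedence). -/
def star (w u : LWord) : LWord := fun n => (w n).orElse (fun _ => u n)

/-- The empty located word. -/
def emptyW : LWord := fun _ => none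

/-- The substitution `T_p`: for `p ≥ 1` it replaces the variable `υ` at position `n`
by `α_p` if `k n ≥ p` and by `α_{k n}` otherwise; `T_0` is the identity. -/
def Tp (k : ℕ → ℕ) (p : ℕ) (w : LWord) : LWord := fun n =>
  match w n with
  | none => none
  | some a => if a = 0 ∧ p ≠ 0 then some (min p (k n)) else some a

/-- The combination `T_{p 0}(w (n 0)) ⋆ ⋯ ⋆ T_{p l}(w (n l))`. -/
def comb (k : ℕ → ℕ) (w : ℕ → LWord) {l : ℕ} (n p : Fin (l + 1) → ℕ) : LWord :=
  (List.ofFn fun i => Tp k (p i) (w (n i))).foldr star emptyW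

/-- `EV(w⃗)`: the extracted variable ω-located words of a sequence `w⃗`. -/
def EV (k : ℕ → ℕ) (w : ℕ → LWord) : Set LWord :=
  {u | ∃ (l : ℕ) (n p : Fin (l + 1) → ℕ), StrictMono n ∧
    (∀ i, p i ≤ k (n i)) ∧ (∃ i, p i = 0) ∧ u = comb k w n p}

/-- `E(w⃗)`: the extracted (constant) ω-located words of a sequence `w⃗`. -/
def Econst (k : ℕ → ℕ) (w : ℕ → LWord) : Set LWord :=
  {u | ∃ (l : ℕ) (n p : Fin (l + 1) → ℕ), StrictMono n ∧
    (∀ i, 1 ≤ p i ∧ p i ≤ k (n i)) ∧ u = comb k w n p}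

/-- An infinite orderly sequence of variable ω-located words, i.e. a member of
`L^∞(Σ,k⃗;υ)`. -/
def OrderlyVar (k : ℕ → ℕ) (w : ℕ → LWord) : Prop :=
  (∀ n, IsVarWord k (w n)) ∧ ∀ n, wlt (w n) (w (n + 1))

/-- `u⃗ ≺ w⃗`: `u⃗` is an extraction of `w⃗`. -/
def Extraction (k : ℕ → ℕ) (u w : ℕ → LWord) : Prop :=
  OrderlyVar k u ∧ ∀ n, u n ∈ EV k w

/-- A finite orderly sequence of variable ω-located words, i.e. a member of
`L^{<∞}(Σ,k⃗;υ)` (the empty list is allowed). -/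
def FinOrderlyV (k : ℕ → ℕ) (ws : List LWord) : Prop :=
  (∀ w ∈ ws, IsVarWord k w) ∧ ws.Chain' wlt

/-- A finite orderly sequence of (constant) ω-located words, i.e. a member of
`L^{<∞}(Σ,k⃗)` (the empty list is allowed). -/
def FinOrderlyC (k : ℕ → ℕ) (ws : List LWord) : Prop :=
  (∀ w ∈ ws, IsConstWord k w) ∧ ws.Chain' wlt

end Farmaki

namespace Farmaki

open Filter

attribute [local instance] Ultrafilter.mul Ultrafilter.semigroup

section IdempotentTheory

variable {S : Type*} [Semigroup S] [TopologicalSpace S] [T2Space S]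

/-- A compact right topological semigroup contains an idempotent that is minimal for the
order `ρ ≤ μ ↔ μ * ρ = ρ ∧ ρ * μ = ρ` on idempotents. -/
theorem exists_minimal_idempotent (hcont : ∀ x : S, Continuous (· * x)) (M : Set S)
    (hne : M.Nonempty) (hM : IsCompact M) (hmul : ∀ x ∈ M, ∀ y ∈ M, x * y ∈ M) :
    ∃ μ ∈ M, μ * μ = μ ∧ ∀ ρ ∈ M, ρ * ρ = ρ → μ * ρ = ρ → ρ * μ = ρ → ρ = μ := by
  let I : Set (Set S) :=
    {L | L ⊆ M ∧ L.Nonempty ∧ IsCompact L ∧ ∀ x ∈ M, ∀ y ∈ L, x * y ∈ L}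
  obtain ⟨L, -, hL⟩ := zorn_superset_nonempty I (by
    intro c hc hchain hcne
    refine ⟨⋂₀ c, ⟨?_, ?_, ?_, ?_⟩, fun s hs => Set.sInter_subset_of_mem hs⟩
    · obtain ⟨t, ht⟩ := hcne
      exact (Set.sInter_subset_of_mem ht).trans (hc ht).1
    · have : Nonempty c := hcne.to_subtype
      exact IsCompact.nonempty_sInter_of_directed_nonempty_isCompact_isClosed
        (IsChain.directedOn hchain.symm) (fun s hs => (hc hs).2.1) (fun s hs => (hc hs).2.2.1)
        (fun s hs => (hc hs).2.2.1.isClosed)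
    · obtain ⟨t, ht⟩ := hcne
      exact (hc ht).2.2.1.of_isClosed_subset
        (isClosed_sInter fun s hs => (hc hs).2.2.1.isClosed) (Set.sInter_subset_of_mem ht)
    · exact fun x hx y hy s hs => (hc hs).2.2.2 x hx y (hy s hs)) M
    ⟨subset_rfl, hne, hM, hmul⟩
  obtain ⟨hLM, hLne, hLc, hLmul⟩ := hL.prop
  obtain ⟨μ, hμ, hidem⟩ := exists_idempotent_in_compact_subsemigroup hcont L hLne hLc
    fun x hx y hy => hLmul x (hLM hx) y hy
  refine ⟨μ, hLM hμ, hidem, fun ρ hρ hρρ hμρ hρμ => ?_⟩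
  have hρL : ρ ∈ L := hρμ ▸ hLmul ρ hρ μ hμ
  have hsub : (· * ρ) '' M ⊆ L := by
    rintro _ ⟨x, hx, rfl⟩
    exact hLmul x hx ρ hρL
  have hI : (· * ρ) '' M ∈ I := by
    refine ⟨hsub.trans hLM, hne.image _, hM.image (hcont ρ), ?_⟩
    rintro x hx _ ⟨y, hy, rfl⟩
    exact ⟨x * y, hmul x hx y hy, mul_assoc x y ρ⟩
  obtain ⟨x, -, hx⟩ := hL.le_of_le hI hsub hμ
  calc ρ = μ * ρ := hμρ.symm
    _ = x * ρ * ρ := by rw [← hx]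
    _ = μ := by rw [mul_assoc, hρρ]; exact hx

/-- If `M` is a compact subsemigroup and `V` is a compact set with `V * V`, `V * M` and `M * V`
contained in `V`, then there are idempotents `μ ∈ M` minimal in `M` and `ν ∈ V` below `μ`. -/
theorem exists_idempotent_le_minimal (hcont : ∀ x : S, Continuous (· * x)) (M V : Set S)
    (hMne : M.Nonempty) (hM : IsCompact M) (hVne : V.Nonempty) (hV : IsCompact V)
    (hMM : ∀ x ∈ M, ∀ y ∈ M, x * y ∈ M) (hVV : ∀ x ∈ V, ∀ y ∈ V, x * y ∈ V)
    (hVM : ∀ x ∈ V, ∀ y ∈ M, x * y ∈ V) (hMV : ∀ x ∈ M, ∀ y ∈ V, x * y ∈ V) :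
    ∃ μ ∈ M, ∃ ν ∈ V, μ * μ = μ ∧ ν * ν = ν ∧ μ * ν = ν ∧ ν * μ = ν ∧
      ∀ ρ ∈ M, ρ * ρ = ρ → μ * ρ = ρ → ρ * μ = ρ → ρ = μ := by
  obtain ⟨μ, hμ, hμμ, hmin⟩ := exists_minimal_idempotent hcont M hMne hM hMM
  obtain ⟨e, ⟨x, hx, rfl⟩, he⟩ := exists_idempotent_in_compact_subsemigroup hcont
    ((· * μ) '' V) (hVne.image _) (hV.image (hcont μ)) (by
      rintro _ ⟨x, hx, rfl⟩ _ ⟨y, hy, rfl⟩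
      exact ⟨x * μ * y, hVV _ (hVM x hx μ hμ) y hy, mul_assoc _ _ _⟩)
  have hxμ : x * μ * μ = x * μ := by rw [mul_assoc, hμμ]
  refine ⟨μ, hμ, μ * (x * μ), hMV _ hμ _ (hVM x hx μ hμ), hμμ, ?_, ?_, ?_, hmin⟩
  · calc μ * (x * μ) * (μ * (x * μ)) = μ * (x * μ * μ * (x * μ)) := by simp only [mul_assoc]
      _ = μ * (x * μ) := by rw [hxμ]; exact congrArg (μ * ·) he
  · rw [← mul_assoc, hμμ]
  · rw [mul_assoc, hxμ]

end IdempotentTheory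

section Construction

variable {S : Type*}

/-- The initial segment of length `n` of a sequence, in reverse order. -/
def revInit (u : ℕ → S) : ℕ → List S
  | 0 => []
  | n + 1 => u n :: revInit u n

theorem length_revInit (u : ℕ → S) (n : ℕ) : (revInit u n).length = n := by
  induction n with
  | zero => rfl
  | succ n ih => simp [revInit, ih]

/-- A property of finite sequences that holds for the empty sequence and can always be extended
holds for all initial segments of some infinite sequence. -/
theorem exists_seq_of_extendable (P : List S → Prop) (h0 : P [])
    (hs : ∀ l, P l → ∃ y, P (y :: l)) : ∃ u : ℕ → S, ∀ n, P (revInit u n) := by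
  choose f hf using hs
  let g : ℕ → {l : List S // P l} :=
    fun n => Nat.rec ⟨[], h0⟩ (fun _ l => ⟨f l.1 l.2 :: l.1, hf l.1 l.2⟩) n
  refine ⟨fun n => f (g n).1 (g n).2, fun n => ?_⟩
  have : revInit (fun n => f (g n).1 (g n).2) n = (g n).1 := by
    induction n with
    | zero => rfl
    | succ n ih => rw [revInit, ih]
  rw [this]
  exact (g n).2

variable [Monoid S]

/-- A partially specified finite sequence of words: `done` lists the completed words and `cur` is
the word being assembled. The flag `track` is `true` for sequences of variable words and `false`
for sequences of constant words; `complete` tells whether `cur` may be appended to `done`. -/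
structure Config (S : Type*) where
  track : Bool
  complete : Bool
  done : List S
  cur : S

/-- Extend the current word by `T p y`; this makes it complete when `p = 0` on the variable track
and when `p ≠ 0` on the constant track. -/
def Config.extend (T : ℕ → S → S) (p : ℕ) (y : S) (c : Config S) : Config S :=
  if c.track = false ∧ p = 0 then c
  else ⟨c.track, c.complete || (decide (p = 0) == c.track), c.done, c.cur * T p y⟩

/-- Append the current word, if it is complete, to the list of completed words. -/
def Config.finish (c : Config S) : Config S :=
  if c.complete then ⟨c.track, false, c.done ++ [c.cur], 1⟩ else c

/-- A configuration is good if almost all of its continuations stay in the tree `G`. -/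
def Config.Good (lam : Bool → Ultrafilter S) (G : Bool → List S → Prop) (c : Config S) : Prop :=
  G c.track c.done ∧ (∀ᶠ y in lam c.track, G c.track (c.done ++ [c.cur * y])) ∧
    (c.complete = true → G c.track (c.done ++ [c.cur]) ∧
      ∀ᶠ y in lam false, G c.track (c.done ++ [c.cur * y]))

/-- The configurations reachable from a finite sequence, given in reverse order, of blocks. -/
def reach (k : ℕ → ℕ) (T : ℕ → S → S) : List S → Set (Config S)
  | [] => {⟨true, false, [], 1⟩, ⟨false, false, [], 1⟩}
  | y :: l =>
    let R := reach k T l ∪ ⋃ p ∈ Set.Iic (k l.length), Config.extend T p y '' reach k T l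
    R ∪ Config.finish '' R

theorem reach_finite (k : ℕ → ℕ) (T : ℕ → S → S) (l : List S) : (reach k T l).Finite := by
  induction l with
  | nil => simp [reach]
  | cons y l ih =>
    have h := ih.union ((Set.finite_Iic (k l.length)).biUnion
      fun p _ => ih.image (Config.extend T p y))
    exact h.union (h.image _)

theorem reach_subset_cons (k : ℕ → ℕ) (T : ℕ → S → S) (y : S) (l : List S) :
    reach k T l ⊆ reach k T (y :: l) :=
  fun _ hc => Or.inl (Or.inl hc)

theorem extend_mem_reach_cons {k : ℕ → ℕ} {T : ℕ → S → S} {y : S} {l : List S} {c : Config S}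
    (hc : c ∈ reach k T l) {p : ℕ} (hp : p ≤ k l.length) :
    c.extend T p y ∈ reach k T (y :: l) :=
  Or.inl (Or.inr (Set.mem_biUnion (Set.mem_Iic.2 hp) ⟨c, hc, rfl⟩))

theorem finish_finish (c : Config S) : c.finish.finish = c.finish := by
  by_cases h : c.complete = true <;> simp [Config.finish, h]

theorem finish_mem_reach {k : ℕ → ℕ} {T : ℕ → S → S} {l : List S} {c : Config S}
    (hc : c ∈ reach k T l) : c.finish ∈ reach k T l := by
  cases l with
  | nil =>
    rcases hc with rfl | rfl
    · exact Or.inl rfl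
    · exact Or.inr rfl
  | cons y l =>
    rcases hc with hc | ⟨c, hc, rfl⟩
    · exact Or.inr ⟨c, hc, rfl⟩
    · exact Or.inr ⟨c, hc, (finish_finish c).symm⟩

variable {lam : Bool → Ultrafilter S} {G : Bool → List S → Prop}

theorem Config.Good.finish (hG : ∀ b t, G b t → ∀ᶠ z in lam b, G b (t ++ [z]))
    {c : Config S} (hc : c.Good lam G) : c.finish.Good lam G := by
  unfold Config.finish
  split_ifs with h
  · have := (hc.2.2 h).1
    exact ⟨this, by simpa using hG _ _ this, by simp⟩
  · exact hc

theorem Config.Good.eventually_extend (hl : ∀ b, lam b * lam b = lam b)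
    (hlr : ∀ b, lam b * lam false = lam b) (hll : ∀ b, lam false * lam b = lam b)
    {T : ℕ → S → S} {p : ℕ} (hT : Ultrafilter.map (T p) (lam true) = lam (decide (p = 0)))
    {c : Config S} (hc : c.Good lam G) :
    ∀ᶠ y in lam true, (c.extend T p y).Good lam G := by
  obtain ⟨b, f, t, x⟩ := c
  obtain ⟨h0, h1, h2⟩ := hc
  simp only at h0 h1 h2
  have hmul : ∀ U V : Ultrafilter S, (∀ᶠ z in (U * V : Ultrafilter S), G b (t ++ [x * z])) →
      ∀ᶠ y in U, ∀ᶠ z in V, G b (t ++ [x * y * z]) := fun U V h => by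
    simpa only [Ultrafilter.eventually_mul, mul_assoc] using h
  by_cases hskip : b = false ∧ p = 0
  · have : ∀ y, (⟨b, f, t, x⟩ : Config S).extend T p y = ⟨b, f, t, x⟩ := fun y => by
      simp [Config.extend, hskip]
    simp only [this]
    exact Eventually.of_forall fun _ => ⟨h0, h1, h2⟩
  have hext : ∀ y, (⟨b, f, t, x⟩ : Config S).extend T p y =
      ⟨b, f || (decide (p = 0) == b), t, x * T p y⟩ := fun y => by
    simp only [Config.extend, if_neg hskip]
  simp only [hext]
  suffices h : ∀ᶠ y in lam (decide (p = 0)),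
      (⟨b, f || (decide (p = 0) == b), t, x * y⟩ : Config S).Good lam G by
    rw [← hT] at h
    exact h
  by_cases hpb : decide (p = 0) = b
  · rw [hpb]
    filter_upwards [h1, hmul (lam b) (lam b) (by rwa [hl]),
      hmul (lam b) (lam false) (by rwa [hlr])] with y hy1 hy2 hy3
    exact ⟨h0, hy2, fun _ => ⟨hy1, hy3⟩⟩
  · have hp : decide (p = 0) = false := by
      cases b <;> simp_all
    have hb : (false == b) = false := by
      cases b <;> simp_all
    rw [hp, hb, Bool.or_false]
    have key := hmul (lam false) (lam b) (by rwa [hll])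
    by_cases hf : f = true
    · filter_upwards [key, (h2 hf).2, hmul (lam false) (lam false) (by rw [hl]; exact (h2 hf).2)]
        with y hy1 hy2 hy3
      exact ⟨h0, hy1, fun _ => ⟨hy2, hy3⟩⟩
    · filter_upwards [key] with y hy
      exact ⟨h0, hy, fun h => absurd h hf⟩

theorem exists_seq_reach_good (k : ℕ → ℕ) (T : ℕ → S → S)
    (hl : ∀ b, lam b * lam b = lam b)
    (hlr : ∀ b, lam b * lam false = lam b) (hll : ∀ b, lam false * lam b = lam b)
    (hT : ∀ n, ∀ p ≤ k n, Ultrafilter.map (T p) (lam true) = lam (decide (p = 0)))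
    (hG0 : ∀ b, G b []) (hG : ∀ b t, G b t → ∀ᶠ z in lam b, G b (t ++ [z]))
    (P : S → Prop) (hP : ∀ᶠ y in lam true, P y)
    (Q : S → S → Prop) (hQ : ∀ x, P x → ∀ᶠ y in lam true, Q x y) :
    ∃ u : ℕ → S, (∀ n, P (u n)) ∧ (∀ n, Q (u n) (u (n + 1))) ∧
      ∀ n, ∀ c ∈ reach k T (revInit u n), c.Good lam G := by
  obtain ⟨u, hu⟩ := exists_seq_of_extendable
    (fun l => (∀ x ∈ l, P x) ∧ l.IsChain (fun y x => Q x y) ∧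
      ∀ c ∈ reach k T l, c.Good lam G) (by
      refine ⟨by simp, by simp, fun c hc => ?_⟩
      rcases hc with rfl | rfl
      · exact ⟨hG0 _, by simpa using hG _ _ (hG0 true), by simp⟩
      · exact ⟨hG0 _, by simpa using hG _ _ (hG0 false), by simp⟩) (by
      rintro l ⟨hPl, hQl, hgood⟩
      have hext : ∀ᶠ y in lam true, ∀ p ∈ Set.Iic (k l.length), ∀ c ∈ reach k T l,
          (c.extend T p y).Good lam G := by
        rw [eventually_all_finite (Set.finite_Iic _)]
        intro p hp
        rw [eventually_all_finite (reach_finite k T l)]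
        exact fun c hc => (hgood c hc).eventually_extend hl hlr hll (hT _ p hp)
      have hQy : ∀ᶠ y in lam true, ∀ x ∈ l.head?, Q x y := by
        cases l with
        | nil => simp
        | cons x l => simpa using hQ x (hPl x (by simp))
      obtain ⟨y, hy, hPy, hQy⟩ := (hext.and (hP.and hQy)).exists
      refine ⟨y, by simpa using ⟨hPy, hPl⟩, List.isChain_cons.2 ⟨hQy, hQl⟩, ?_⟩
      have hR : ∀ c ∈ reach k T l ∪ ⋃ p ∈ Set.Iic (k l.length),
          Config.extend T p y '' reach k T l, c.Good lam G := by
        rintro c (hc | hc)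
        · exact hgood c hc
        · obtain ⟨p, hp, c, hc', rfl⟩ := Set.mem_iUnion₂.1 hc
          exact hy p hp c hc'
      rintro c (hc | ⟨c, hc, rfl⟩)
      · exact hR c hc
      · exact (hR c hc).finish hG)
  refine ⟨u, fun n => (hu (n + 1)).1 _ (by simp [revInit]), fun n => ?_, fun n => (hu n).2.2⟩
  have := (hu (n + 2)).2.1
  simp only [revInit, List.isChain_cons_cons] at this
  exact this.1

theorem reach_revInit_mono (k : ℕ → ℕ) (T : ℕ → S → S) (u : ℕ → S) :
    Monotone fun n => reach k T (revInit u n) :=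
  monotone_nat_of_le_succ fun n => reach_subset_cons k T (u n) (revInit u n)

/-- The product of the blocks `T q.2 (u q.1)` for `q` ranging over `L`. -/
def eval (T : ℕ → S → S) (u : ℕ → S) (L : List (ℕ × ℕ)) : S :=
  (L.map fun q => T q.2 (u q.1)).prod

/-- `L` is a code of a variable word (`b = true`) or of a constant word (`b = false`). -/
def IsCode (k : ℕ → ℕ) (b : Bool) (L : List (ℕ × ℕ)) : Prop :=
  L.Pairwise (fun q q' => q.1 < q'.1) ∧ (∀ q ∈ L, q.2 ≤ k q.1 ∧ (b = false → q.2 ≠ 0)) ∧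
    ∃ q ∈ L, decide (q.2 = 0) = b

theorem mul_eval_mem_reach {k : ℕ → ℕ} {T : ℕ → S → S} {u : ℕ → S} {b : Bool} {t : List S}
    {L : List (ℕ × ℕ)} (hL : L.Pairwise (fun q q' => q.1 < q'.1))
    (hk : ∀ q ∈ L, q.2 ≤ k q.1 ∧ (b = false → q.2 ≠ 0)) {m N : ℕ} (hm : ∀ q ∈ L, m ≤ q.1)
    (hN : ∀ q ∈ L, q.1 < N) (hmN : m ≤ N) {f : Bool} {x : S}
    (hx : ⟨b, f, t, x⟩ ∈ reach k T (revInit u m)) :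
    ⟨b, f || L.any (fun q => decide (q.2 = 0) == b), t, x * eval T u L⟩ ∈
      reach k T (revInit u N) := by
  induction L generalizing m f x with
  | nil => simpa [eval] using reach_revInit_mono k T u hmN hx
  | cons q L ih =>
    rw [List.pairwise_cons] at hL
    simp only [List.mem_cons, forall_eq_or_imp] at hk hm hN
    have h1 := reach_revInit_mono k T u hm.1 hx
    have h2 : _ ∈ reach k T (revInit u (q.1 + 1)) :=
      extend_mem_reach_cons (y := u q.1) h1 (p := q.2) (by rw [length_revInit]; exact hk.1.1)
    have hskip : ¬ (b = false ∧ q.2 = 0) := fun h => hk.1.2 h.1 h.2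
    simp only [Config.extend, if_neg hskip] at h2
    have h3 := ih hL.2 hk.2 (fun q' hq' => hL.1 q' hq') hN.2 hN.1 h2
    simpa [eval, mul_assoc, Bool.or_assoc] using h3

theorem append_mem_reach {k : ℕ → ℕ} {T : ℕ → S → S} {u : ℕ → S} {b : Bool} {t : List S}
    {L : List (ℕ × ℕ)} (hL : IsCode k b L) {m N : ℕ} (hm : ∀ q ∈ L, m ≤ q.1)
    (hN : ∀ q ∈ L, q.1 < N) (hx : ⟨b, false, t, 1⟩ ∈ reach k T (revInit u m)) :
    ⟨b, false, t ++ [eval T u L], 1⟩ ∈ reach k T (revInit u N) := by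
  obtain ⟨hs, hk, q, hq, hqb⟩ := hL
  have h := finish_mem_reach
    (mul_eval_mem_reach hs hk hm hN ((hm q hq).trans (hN q hq).le) hx)
  have hany : L.any (fun q => decide (q.2 = 0) == b) = true :=
    List.any_eq_true.2 ⟨q, hq, by simpa using hqb⟩
  simpa [Config.finish, hany] using h

theorem append_list_mem_reach {k : ℕ → ℕ} {T : ℕ → S → S} {u : ℕ → S} {b : Bool}
    {lt : S → S → Prop}
    (hlt : ∀ L L', IsCode k b L → IsCode k b L' → lt (eval T u L) (eval T u L') →
      ∀ q ∈ L, ∀ q' ∈ L', q.1 < q'.1)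
    {ws : List S} (hws : ws.IsChain lt) (hcode : ∀ z ∈ ws, ∃ L, IsCode k b L ∧ z = eval T u L)
    {t : List S} {m : ℕ} (hx : ⟨b, false, t, 1⟩ ∈ reach k T (revInit u m))
    (hm : ∀ z ∈ ws.head?, ∀ L, IsCode k b L → z = eval T u L → ∀ q ∈ L, m ≤ q.1) :
    ∃ N, ⟨b, false, t ++ ws, 1⟩ ∈ reach k T (revInit u N) := by
  induction ws generalizing t m with
  | nil => exact ⟨m, by simpa using hx⟩
  | cons z ws ih =>
    obtain ⟨L, hL, rfl⟩ := hcode z (by simp)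
    rw [List.isChain_cons] at hws
    obtain ⟨q₀, hq₀, hmax⟩ := L.toFinset.exists_max_image Prod.fst
      (by obtain ⟨q, hq, -⟩ := hL.2.2; exact ⟨q, by simpa using hq⟩)
    simp only [List.mem_toFinset] at hq₀ hmax
    have h := append_mem_reach hL (hm _ (by simp) L hL rfl)
      (N := q₀.1 + 1) (fun q hq => Nat.lt_succ_of_le (hmax q hq)) hx
    obtain ⟨N, hN⟩ := ih hws.2 (fun z hz => hcode z (by simp [hz])) h (by
      rintro z hz L' hL' rfl q' hq'
      exact hlt L L' hL hL' (hws.1 _ hz) q₀ hq₀ q' hq')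
    exact ⟨N, by simpa using hN⟩

end Construction

section LocatedWords

instance : Monoid LWord where
  mul := star
  mul_assoc x y z := by
    funext n
    change ((x n).orElse fun _ => y n).orElse (fun _ => z n) =
      (x n).orElse fun _ => (y n).orElse fun _ => z n
    cases x n <;> rfl
  one := emptyW
  one_mul x := rfl
  mul_one x := by
    funext n
    change (x n).orElse (fun _ => none) = x n
    cases x n <;> rfl

theorem mul_apply (x y : LWord) (n : ℕ) : (x * y) n = (x n).orElse fun _ => y n := rfl

variable {k : ℕ → ℕ}

theorem Tp_apply (p : ℕ) (x : LWord) (n : ℕ) :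
    Tp k p x n = (x n).map fun a => if a = 0 ∧ p ≠ 0 then min p (k n) else a := by
  unfold Tp
  cases x n with
  | none => rfl
  | some a => simp only [Option.map_some]; split_ifs <;> rfl

theorem Tp_eq_none {p : ℕ} {x : LWord} {n : ℕ} : Tp k p x n = none ↔ x n = none := by
  rw [Tp_apply, Option.map_eq_none_iff]

theorem Tp_zero (x : LWord) : Tp k 0 x = x := by
  funext n
  simp [Tp_apply]

theorem Tp_mul (p : ℕ) (x y : LWord) : Tp k p (x * y) = Tp k p x * Tp k p y := by
  funext n
  simp only [mul_apply, Tp_apply]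
  cases x n <;> rfl

theorem Tp_Tp (hk : ∀ n, 0 < k n) (p q : ℕ) (x : LWord) :
    Tp k p (Tp k q x) = Tp k (if q = 0 then p else q) x := by
  funext n
  have := hk n
  simp only [Tp_apply, Option.map_map]
  congr 1
  funext a
  simp only [Function.comp_apply]
  grind

theorem Tp_eval (hk : ∀ n, 0 < k n) (w : ℕ → LWord) (p : ℕ) (L : List (ℕ × ℕ)) :
    Tp k p (eval (Tp k) w L) =
      eval (Tp k) w (L.map fun q => (q.1, if q.2 = 0 then p else q.2)) := by
  induction L with
  | nil => rfl
  | cons q L ih =>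
    simp only [eval, List.map_cons, List.prod_cons] at ih ⊢
    rw [Tp_mul, Tp_Tp hk, ih]

theorem eval_append (T : ℕ → LWord → LWord) (w : ℕ → LWord) (L L' : List (ℕ × ℕ)) :
    eval T w (L ++ L') = eval T w L * eval T w L' := by
  simp [eval]

theorem eval_cons (T : ℕ → LWord → LWord) (w : ℕ → LWord) (q : ℕ × ℕ) (L : List (ℕ × ℕ)) :
    eval T w (q :: L) = T q.2 (w q.1) * eval T w L := by
  simp [eval]

theorem comb_eq_eval (w : ℕ → LWord) {l : ℕ} (n p : Fin (l + 1) → ℕ) :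
    comb k w n p = eval (Tp k) w (List.ofFn fun i => (n i, p i)) := by
  rw [eval, List.map_ofFn, List.prod_eq_foldr]
  rfl

theorem exists_code_of_mem_EV {w : ℕ → LWord} {x : LWord} (hx : x ∈ EV k w) :
    ∃ L, IsCode k true L ∧ x = eval (Tp k) w L := by
  obtain ⟨l, n, p, hn, hp, ⟨i, hi⟩, rfl⟩ := hx
  refine ⟨_, ⟨?_, ?_, ?_⟩, comb_eq_eval w n p⟩
  · exact List.pairwise_ofFn.2 fun i j hij => hn hij
  · simp only [List.mem_ofFn]
    rintro _ ⟨j, rfl⟩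
    exact ⟨hp j, by simp⟩
  · exact ⟨_, List.mem_ofFn.2 ⟨i, rfl⟩, by simp [hi]⟩

theorem exists_code_of_mem_Econst {w : ℕ → LWord} {x : LWord} (hx : x ∈ Econst k w) :
    ∃ L, IsCode k false L ∧ x = eval (Tp k) w L := by
  obtain ⟨l, n, p, hn, hp, rfl⟩ := hx
  refine ⟨_, ⟨?_, ?_, ?_⟩, comb_eq_eval w n p⟩
  · exact List.pairwise_ofFn.2 fun i j hij => hn hij
  · simp only [List.mem_ofFn]
    rintro _ ⟨j, rfl⟩
    exact ⟨(hp j).2, fun _ => Nat.one_le_iff_ne_zero.1 (hp j).1⟩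
  · exact ⟨_, List.mem_ofFn.2 ⟨0, rfl⟩, by simpa using Nat.one_le_iff_ne_zero.1 (hp 0).1⟩

theorem eval_mem_EV {w : ℕ → LWord} {L : List (ℕ × ℕ)} (hL : IsCode k true L) :
    eval (Tp k) w L ∈ EV k w := by
  obtain ⟨hs, hk, q, hq, hq0⟩ := hL
  obtain ⟨i, hi, rfl⟩ := List.getElem_of_mem hq
  obtain ⟨l, hl⟩ : ∃ l, L.length = l + 1 := ⟨L.length - 1, by omega⟩
  refine ⟨l, fun i => (L.get (i.cast hl.symm)).1, fun i => (L.get (i.cast hl.symm)).2,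
    ?_, ?_, ?_, ?_⟩
  · exact fun i j hij => List.pairwise_iff_get.1 hs _ _ hij
  · exact fun i => (hk _ (List.get_mem _ _)).1
  · exact ⟨⟨i, hl ▸ hi⟩, by simpa using hq0⟩
  · rw [comb_eq_eval]
    congr 1
    apply List.ext_getElem <;> simp [hl, -List.ofFn_succ]

theorem OrderlyVar.wlt_of_lt {w : ℕ → LWord} (hw : OrderlyVar k w) {i j : ℕ}
    (hij : i < j) : wlt (w i) (w j) := by
  induction hij with
  | refl => exact hw.2 i
  | @step j _ ih =>
    intro a b ha hb
    obtain ⟨c, hc⟩ := (hw.1 j).2.1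
    exact (ih a c ha hc).trans (hw.2 j c b hc hb)

theorem OrderlyVar.le_of_ne_none {w : ℕ → LWord} (hw : OrderlyVar k w)
    {i a : ℕ} (ha : w i a ≠ none) : i ≤ a := by
  induction i generalizing a with
  | zero => exact Nat.zero_le a
  | succ i ih =>
    obtain ⟨c, hc⟩ := (hw.1 i).2.1
    exact (ih hc).trans_lt (hw.2 i c a hc ha)

theorem OrderlyVar.eval_apply {w : ℕ → LWord} (hw : OrderlyVar k w)
    {L : List (ℕ × ℕ)} (hL : L.Pairwise (fun q q' => q.1 < q'.1))
    {q : ℕ × ℕ} (hq : q ∈ L) {a : ℕ} (ha : w q.1 a ≠ none) :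
    eval (Tp k) w L a = Tp k q.2 (w q.1) a := by
  induction L with
  | nil => simp at hq
  | cons q₀ L ih =>
    rw [List.pairwise_cons] at hL
    rw [eval_cons, mul_apply]
    rcases List.mem_cons.1 hq with rfl | hq
    · obtain ⟨v, hv⟩ := Option.ne_none_iff_exists'.1 (mt (Tp_eq_none (k := k) (p := q.2)).1 ha)
      rw [hv]
      rfl
    · have h0 : w q₀.1 a = none := by
        by_contra h
        exact lt_irrefl a (hw.wlt_of_lt (hL.1 q hq) a a h ha)
      rw [Tp_eq_none.2 h0]
      exact ih hL.2 hq

theorem exists_ne_none_of_eval {w : ℕ → LWord} {L : List (ℕ × ℕ)} {a : ℕ}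
    (ha : eval (Tp k) w L a ≠ none) :
    ∃ q ∈ L, w q.1 a ≠ none := by
  induction L with
  | nil => exact absurd rfl ha
  | cons q L ih =>
    by_cases h : w q.1 a = none
    · rw [eval_cons, mul_apply, Tp_eq_none.2 h] at ha
      obtain ⟨q', hq', h'⟩ := ih ha
      exact ⟨q', List.mem_cons_of_mem _ hq', h'⟩
    · exact ⟨q, List.mem_cons_self, h⟩

theorem OrderlyVar.isVarWord_eval {w : ℕ → LWord} (hw : OrderlyVar k w)
    {L : List (ℕ × ℕ)} (hL : IsCode k true L) :
    IsVarWord k (eval (Tp k) w L) := by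
  obtain ⟨hs, hp, q, hq, hq0⟩ := hL
  obtain ⟨a, ha⟩ := (hw.1 q.1).2.2.2
  have hval : eval (Tp k) w L a = some 0 := by
    rw [hw.eval_apply hs hq (by simp [ha]), of_decide_eq_true hq0, Tp_zero, ha]
  refine ⟨?_, ⟨a, by simp [dom, hval]⟩, ?_, a, hval⟩
  · refine (L.toFinset.finite_toSet.biUnion fun q _ => (hw.1 q.1).1).subset fun a ha => ?_
    obtain ⟨q, hq, h⟩ := exists_ne_none_of_eval ha
    exact Set.mem_biUnion (by simpa using hq) h
  · intro b v hv
    obtain ⟨q, hq, h⟩ := exists_ne_none_of_eval (a := b) (by rw [hv]; simp)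
    obtain ⟨c, hc⟩ := Option.ne_none_iff_exists'.1 h
    rw [hw.eval_apply hs hq h, Tp_apply, hc, Option.map_some, Option.some_inj] at hv
    have := (hw.1 q.1).2.2.1 b c hc
    split_ifs at hv <;> omega

theorem OrderlyVar.lt_of_wlt_eval {w : ℕ → LWord} (hw : OrderlyVar k w)
    {L L' : List (ℕ × ℕ)}
    (hL : L.Pairwise (fun q q' => q.1 < q'.1)) (hL' : L'.Pairwise (fun q q' => q.1 < q'.1))
    (hlt : wlt (eval (Tp k) w L) (eval (Tp k) w L')) {q q' : ℕ × ℕ} (hq : q ∈ L)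
    (hq' : q' ∈ L') : q.1 < q'.1 := by
  obtain ⟨a, ha⟩ := (hw.1 q.1).2.1
  obtain ⟨b, hb⟩ := (hw.1 q'.1).2.1
  have hLa : ∀ {c}, w q.1 c ≠ none → eval (Tp k) w L c ≠ none := fun hc => by
    rw [hw.eval_apply hL hq hc]
    exact mt Tp_eq_none.1 hc
  have hLb : eval (Tp k) w L' b ≠ none := by
    rw [hw.eval_apply hL' hq' hb]
    exact mt Tp_eq_none.1 hb
  by_contra! h
  rcases h.eq_or_lt with h | h
  · exact lt_irrefl b (hlt b b (hLa (h ▸ hb)) hLb)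
  · exact lt_asymm (hlt a b (hLa ha) hLb) (hw.wlt_of_lt h b a hb ha)

/-- The extracted variable (`b = true`) or constant (`b = false`) words of `w` that only use terms
of index at least `a`. -/
def tailWords (k : ℕ → ℕ) (w : ℕ → LWord) (b : Bool) (a : ℕ) : Set LWord :=
  {x | ∃ L, IsCode k b L ∧ (∀ q ∈ L, a ≤ q.1) ∧ x = eval (Tp k) w L}

/-- The ultrafilters concentrated on extracted words with arbitrarily large indices. -/
def tailUltrafilters (k : ℕ → ℕ) (w : ℕ → LWord) (b : Bool) : Set (Ultrafilter LWord) :=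
  {U | ∀ a, ∀ᶠ x in U, x ∈ tailWords k w b a}

theorem isCompact_tailUltrafilters (w : ℕ → LWord) (b : Bool) :
    IsCompact (tailUltrafilters k w b) := by
  have : tailUltrafilters k w b = ⋂ a, {U | tailWords k w b a ∈ U} := by
    ext U
    simp [tailUltrafilters, Filter.Eventually]
  rw [this]
  exact (isClosed_iInter fun a => ultrafilter_isClosed_basic _).isCompact

theorem tailUltrafilters_nonempty (hk : ∀ n, 0 < k n) (w : ℕ → LWord) (b : Bool) :
    (tailUltrafilters k w b).Nonempty := by
  refine ⟨(hyperfilter ℕ).map fun n => Tp k (if b then 0 else 1) (w n), fun a => ?_⟩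
  have hev : ∀ᶠ n in (hyperfilter ℕ : Filter ℕ), a ≤ n :=
    Nat.hyperfilter_le_atTop (eventually_ge_atTop a)
  rw [Ultrafilter.coe_map, eventually_map]
  filter_upwards [hev] with n hn
  refine ⟨[(n, if b then 0 else 1)], ⟨by simp, ?_, ?_⟩, by simpa using hn, by simp [eval]⟩
  · have := hk n
    cases b <;> simp
    omega
  · cases b <;> simp

theorem mul_mem_tailUltrafilters {w : ℕ → LWord} {b c : Bool} {U V : Ultrafilter LWord}
    (hU : U ∈ tailUltrafilters k w b) (hV : V ∈ tailUltrafilters k w c) :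
    U * V ∈ tailUltrafilters k w (b || c) := by
  intro a
  rw [Ultrafilter.eventually_mul]
  filter_upwards [hU a]
  rintro _ ⟨L, ⟨hs, hp, q, hq, hqb⟩, ha, rfl⟩
  obtain ⟨q₀, -, hmax⟩ := L.toFinset.exists_max_image Prod.fst ⟨q, by simpa using hq⟩
  simp only [List.mem_toFinset] at hmax
  filter_upwards [hV (max a (q₀.1 + 1))]
  rintro _ ⟨L', ⟨hs', hp', q', hq', hqc⟩, ha', rfl⟩
  refine ⟨L ++ L', ⟨?_, ?_, ?_⟩, ?_, (eval_append _ _ _ _).symm⟩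
  · refine List.pairwise_append.2 ⟨hs, hs', fun x hx y hy => ?_⟩
    have := hmax x hx
    have := ha' y hy
    omega
  · intro x hx
    rw [Bool.or_eq_false_iff]
    rcases List.mem_append.1 hx with hx | hx
    · exact ⟨(hp x hx).1, fun h => (hp x hx).2 h.1⟩
    · exact ⟨(hp' x hx).1, fun h => (hp' x hx).2 h.2⟩
  · cases b with
    | true => exact ⟨q, List.mem_append_left _ hq, by simpa using hqb⟩
    | false => exact ⟨q', List.mem_append_right _ hq', by simpa using hqc⟩
  · intro x hx
    rcases List.mem_append.1 hx with hx | hx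
    · exact ha x hx
    · exact (le_max_left _ _).trans (ha' x hx)

theorem map_Tp_mul (p : ℕ) (U V : Ultrafilter LWord) :
    (U * V).map (Tp k p) = U.map (Tp k p) * V.map (Tp k p) := by
  refine Ultrafilter.coe_inj.1 (Filter.ext' fun P => ?_)
  rw [Ultrafilter.eventually_mul]
  simp only [Ultrafilter.coe_map, eventually_map, Ultrafilter.eventually_mul, Tp_mul]

theorem map_Tp_of_mem_false (hk : ∀ n, 0 < k n) {w : ℕ → LWord} (p : ℕ)
    {U : Ultrafilter LWord} (hU : U ∈ tailUltrafilters k w false) : U.map (Tp k p) = U := by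
  have h : Tp k p =ᶠ[(U : Filter LWord)] id := by
    filter_upwards [hU 0]
    rintro _ ⟨L, hL, -, rfl⟩
    rw [Tp_eval hk, id]
    congr 1
    conv_rhs => rw [← List.map_id L]
    refine List.map_congr_left fun q hq => ?_
    simp [(hL.2.1 q hq).2 rfl]
  refine Ultrafilter.coe_inj.1 ?_
  rw [Ultrafilter.coe_map, map_congr h, map_id]

theorem map_Tp_mem_tailUltrafilters (hk : ∀ n, 0 < k n) (hmono : Monotone k) {w : ℕ → LWord}
    {p n : ℕ} (hp : p ≠ 0) (hpn : p ≤ k n) {U : Ultrafilter LWord}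
    (hU : U ∈ tailUltrafilters k w true) : U.map (Tp k p) ∈ tailUltrafilters k w false := by
  intro a
  rw [Ultrafilter.coe_map, eventually_map]
  filter_upwards [hU (max a n)]
  rintro _ ⟨L, ⟨hs, hle, q, hq, -⟩, ha, rfl⟩
  have hne : ∀ q : ℕ × ℕ, (if q.2 = 0 then p else q.2) ≠ 0 := fun q => by split_ifs <;> assumption
  refine ⟨L.map fun q => (q.1, if q.2 = 0 then p else q.2),
    ⟨List.pairwise_map.2 hs, ?_, ?_⟩, ?_, Tp_eval hk w p L⟩
  · rintro _ hx
    obtain ⟨q, hq, rfl⟩ := List.mem_map.1 hx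
    refine ⟨?_, fun _ => hne q⟩
    have h1 := (hle q hq).1
    have h2 := hpn.trans (hmono ((le_max_right a n).trans (ha q hq)))
    dsimp only
    split_ifs <;> assumption
  · exact ⟨_, List.mem_map.2 ⟨q, hq, rfl⟩, by simpa using hne q⟩
  · rintro _ hx
    obtain ⟨q, hq, rfl⟩ := List.mem_map.1 hx
    exact (le_max_left a n).trans (ha q hq)

/-- There are idempotent ultrafilters on the extracted variable words and on the extracted
constant words of `w` that are compatible with multiplication and with all substitutions. -/
theorem exists_compatible_ultrafilters (hk : ∀ n, 0 < k n) (hmono : Monotone k)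
    (w : ℕ → LWord) :
    ∃ lam : Bool → Ultrafilter LWord, (∀ b, lam b ∈ tailUltrafilters k w b) ∧
      (∀ b, lam b * lam b = lam b) ∧ (∀ b, lam b * lam false = lam b) ∧
      (∀ b, lam false * lam b = lam b) ∧
      ∀ n, ∀ p ≤ k n, (lam true).map (Tp k p) = lam (decide (p = 0)) := by
  have hmul : ∀ b c, ∀ U ∈ tailUltrafilters k w b, ∀ V ∈ tailUltrafilters k w c,
      U * V ∈ tailUltrafilters k w (b || c) :=
    fun _ _ _ hU _ hV => mul_mem_tailUltrafilters hU hV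
  obtain ⟨μ, hμ, ν, hν, hμμ, hνν, hμν, hνμ, hmin⟩ :=
    exists_idempotent_le_minimal Ultrafilter.continuous_mul_left
      (tailUltrafilters k w false) (tailUltrafilters k w true)
      (tailUltrafilters_nonempty hk w _) (isCompact_tailUltrafilters w _)
      (tailUltrafilters_nonempty hk w _) (isCompact_tailUltrafilters w _)
      (hmul false false) (hmul true true) (hmul true false) (hmul false true)
  refine ⟨fun b => if b then ν else μ, ?_, ?_, ?_, ?_, fun n p hp => ?_⟩
  · rintro (_ | _) <;> simpa
  · rintro (_ | _) <;> simpa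
  · rintro (_ | _) <;> simpa
  · rintro (_ | _) <;> simpa
  · by_cases h0 : p = 0
    · subst h0
      have : Tp k 0 = id := funext Tp_zero
      simp [this]
    · have hμp := map_Tp_of_mem_false hk p hμ
      simp only [h0, if_true, decide_false, Bool.false_eq_true, if_false]
      refine hmin _ (map_Tp_mem_tailUltrafilters hk hmono h0 hp hν) ?_ ?_ ?_
      · rw [← map_Tp_mul, hνν]
      · rw [← hμp, ← map_Tp_mul, hμν]
      · rw [← hμp, ← map_Tp_mul, hνμ]

theorem eventually_wlt {w : ℕ → LWord} (hw : OrderlyVar k w) {b : Bool} {U : Ultrafilter LWord}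
    (hU : U ∈ tailUltrafilters k w b) {x : LWord} (hx : (dom x).Finite) :
    ∀ᶠ y in U, wlt x y := by
  obtain ⟨N, hN⟩ := hx.bddAbove
  filter_upwards [hU (N + 1)]
  rintro _ ⟨L, -, hL, rfl⟩ a c ha hc
  obtain ⟨q, hq, hqc⟩ := exists_ne_none_of_eval hc
  have := hL q hq
  have := hw.le_of_ne_none hqc
  have : a ≤ N := hN ha
  omega

/-- For a finite cover of the admissible lists there is a tree of lists, in which almost every
one-step extension of a node is a node, such that all admissible nodes whose length is `minDom` of
their first term lie in a single set of the cover. -/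
theorem exists_tree (U : Ultrafilter LWord) (adm : List LWord → Prop) {r : ℕ} (hr : 0 < r)
    (A : Fin r → Set (List LWord)) (hA : ∀ ws, adm ws → ∃ i, ws ∈ A i) :
    ∃ (i : Fin r) (G : List LWord → Prop), G [] ∧ (∀ t, G t → ∀ᶠ z in U, G (t ++ [z])) ∧
      ∀ (ws : List LWord) (h : ws ≠ []), adm ws → minDom (ws.head h) = ws.length → G ws →
        ws ∈ A i := by
  let D : Fin r → ℕ → List LWord → Prop := fun i j => Nat.rec (fun t => adm t → t ∈ A i)
    (fun _ P t => ∀ᶠ z in U, P (t ++ [z])) j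
  have hD : ∀ j t, ∃ i, D i j t := by
    intro j
    induction j with
    | zero =>
      intro t
      by_cases ht : adm t
      · obtain ⟨i, hi⟩ := hA t ht
        exact ⟨i, fun _ => hi⟩
      · exact ⟨⟨0, hr⟩, fun h => absurd h ht⟩
    | succ j ih =>
      intro t
      exact Ultrafilter.eventually_exists_iff.1 (Eventually.of_forall fun z => ih (t ++ [z]))
  obtain ⟨i, hi⟩ : ∃ i, ∀ᶠ z in U, D i (minDom z - 1) [z] :=
    Ultrafilter.eventually_exists_iff.1 (Eventually.of_forall fun z => hD _ [z])
  refine ⟨i, fun t => ∀ h : t ≠ [], t.length ≤ minDom (t.head h) →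
    D i (minDom (t.head h) - t.length) t, fun h => absurd rfl h, fun t ht => ?_,
    fun ws h hadm hlen hG => ?_⟩
  · rcases eq_or_ne t [] with rfl | hne
    · filter_upwards [hi] with z hz _ _
      exact hz
    · by_cases hlen : t.length < minDom (t.head hne)
      · have h := ht hne hlen.le
        obtain ⟨j, hj⟩ : ∃ j, minDom (t.head hne) - t.length = j + 1 :=
          ⟨minDom (t.head hne) - t.length - 1, by omega⟩
        rw [hj] at h
        have h' : ∀ᶠ z in U, D i j (t ++ [z]) := h
        filter_upwards [h'] with z hz _ _
        rw [List.head_append_of_ne_nil hne, List.length_append, List.length_singleton]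
        rwa [show minDom (t.head hne) - (t.length + 1) = j by omega]
      · refine Eventually.of_forall fun z _ hz => ?_
        rw [List.head_append_of_ne_nil hne, List.length_append, List.length_singleton] at hz
        omega
  · have h' := hG h hlen.ge
    rw [hlen, Nat.sub_self] at h'
    exact h' hadm

end LocatedWords

/-- **Corollary 2.12** (ω-Ramsey type partition theorem for ω-located words).
For finite partitions of `L^{<∞}(Σ,k⃗;υ)` and `L^{<∞}(Σ,k⃗)` there is an extraction
`u⃗ ≺ w⃗` such that all orderly sequences `(z₁,…,zₙ)` with `min dom(z₁) = n` taken from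
`EV(u⃗)` (resp. `E(u⃗)`) lie in one cell. -/
theorem ramsey_omega_dimensional
    (k : ℕ → ℕ) (hk : ∀ n, 0 < k n) (hmono : Monotone k)
    (r s : ℕ) (hr : 0 < r) (hs : 0 < s)
    (A : Fin r → Set (List LWord)) (C : Fin s → Set (List LWord))
    (hA : ∀ ws : List LWord, FinOrderlyV k ws → ∃ i, ws ∈ A i)
    (hC : ∀ ws : List LWord, FinOrderlyC k ws → ∃ j, ws ∈ C j)
    (w : ℕ → LWord) (hw : OrderlyVar k w) :
    ∃ u : ℕ → LWord, Extraction k u w ∧ ∃ (i₀ : Fin r) (j₀ : Fin s),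
      (∀ (ws : List LWord) (h : ws ≠ []), FinOrderlyV k ws →
        minDom (ws.head h) = ws.length → (∀ z ∈ ws, z ∈ EV k u) → ws ∈ A i₀) ∧
      (∀ (ws : List LWord) (h : ws ≠ []), FinOrderlyC k ws →
        minDom (ws.head h) = ws.length → (∀ z ∈ ws, z ∈ Econst k u) → ws ∈ C j₀) := by
  obtain ⟨lam, hlam, hl, hlr, hll, hT⟩ := exists_compatible_ultrafilters hk hmono w
  obtain ⟨i₀, GV, hV0, hV, hVA⟩ := exists_tree (lam true) (FinOrderlyV k) hr A hA
  obtain ⟨j₀, GC, hC0, hCs, hCC⟩ := exists_tree (lam false) (FinOrderlyC k) hs C hC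
  obtain ⟨u, huP, huQ, hgood⟩ := exists_seq_reach_good (lam := lam)
    (G := fun b => if b then GV else GC) k (Tp k) hl hlr hll hT
    (by rintro (_ | _) <;> simpa) (by rintro (_ | _) <;> simpa)
    (fun x => x ∈ tailWords k w true 0) (hlam true 0) wlt (by
      rintro _ ⟨L, hL, -, rfl⟩
      exact eventually_wlt hw (hlam true) (hw.isVarWord_eval hL).1)
  have hu : Extraction k u w := by
    choose L hL _ hLu using huP
    exact ⟨⟨fun n => hLu n ▸ hw.isVarWord_eval (hL n), huQ⟩, fun n => hLu n ▸ eval_mem_EV (hL n)⟩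
  have key : ∀ (b : Bool) (ws : List LWord), ws.IsChain wlt →
      (∀ z ∈ ws, ∃ L, IsCode k b L ∧ z = eval (Tp k) u L) → (if b then GV else GC) ws := by
    intro b ws hws hcode
    obtain ⟨N, hN⟩ := append_list_mem_reach (t := []) (m := 0)
      (fun L L' hL hL' hlt q hq q' hq' => hu.1.lt_of_wlt_eval hL.1 hL'.1 hlt hq hq')
      hws hcode (by cases b <;> simp [reach, revInit]) (by simp)
    exact (hgood N _ hN).1
  exact ⟨u, hu, i₀, j₀,
    fun ws h hadm hlen hz => hVA ws h hadm hlen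
      (key true ws hadm.2 fun z hzw => exists_code_of_mem_EV (hz z hzw)),
    fun ws h hadm hlen hz => hCC ws h hadm hlen
      (key false ws hadm.2 fun z hzw => exists_code_of_mem_Econst (hz z hzw))⟩

end Farmaki
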